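/- The interval I_str(Λ ∩ T_1) has the cardinality of the continuum (2^{ℵ₀}), where Λ is the total clone on 𝟚 generated by the binary conjunction ∧ and the constant functions c_0, c_1, and T_1 := Pol {{(1)}} is the clone of all total Boolean functions f with f(1,…,1) = 1. -/

import Mathlib

namespace StrongPartial

/-- Partial functions of arity `n+1` on `A` (arities are `≥ 1`).
`f.2 x = some a` means `x ∈ dom f` with value `a`; `f.2 x = none` means `x ∉ dom f`. -/
def PF (A : Type) : Type := Σ n : ℕ, (Fin (n+1) → A) → Option A

variable {A : Type}

/-- `f` is a total function. -/
def IsTotalPF (f : PF A) : Prop := ∀ x, (f.2 x).isSome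

/-- The set of all total functions on `A`. -/
def OSet (A : Type) : Set (PF A) := {f | IsTotalPF f}

/-- The `(n+1)`-ary projection onto the `i`-th coordinate. -/
def proj (n : ℕ) (i : Fin (n+1)) : PF A := ⟨n, fun x => some (x i)⟩

/-- Composition of an arity-`k` partial function with `k` partial functions of arity `m`. -/
def compFun {k m : ℕ} (f : (Fin k → A) → Option A) (g : Fin k → ((Fin m → A) → Option A)) :
    (Fin m → A) → Option A :=
  fun x => if h : ∀ i, (g i x).isSome then f (fun i => (g i x).get (h i)) else none

/-- A partial clone: contains all projections and is closed under composition. -/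
def IsPartialClone (X : Set (PF A)) : Prop :=
  (∀ (n : ℕ) (i : Fin (n+1)), proj n i ∈ X) ∧
  (∀ f ∈ X, ∀ (m : ℕ) (g : Fin (f.1+1) → ((Fin (m+1) → A) → Option A)),
     (∀ i, (⟨m, g i⟩ : PF A) ∈ X) → (⟨m, compFun f.2 g⟩ : PF A) ∈ X)

/-- A total clone: a partial clone consisting of total functions. -/
def IsClone (C : Set (PF A)) : Prop := IsPartialClone C ∧ C ⊆ OSet A

/-- `f ≤ g`: `f` is a restriction (subfunction) of `g`. -/
def PFle (f g : PF A) : Prop :=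
  ∃ h : f.1 = g.1, ∀ (x : Fin (f.1+1) → A) (a : A),
    f.2 x = some a → g.2 (fun i => x (Fin.cast (by rw [h]) i)) = some a

/-- `Str X`: all restrictions of members of `X`. -/
def StrSet (X : Set (PF A)) : Set (PF A) := {f | ∃ g ∈ X, PFle f g}

/-- `X` is strong (restriction closed). -/
def IsStrong (X : Set (PF A)) : Prop := StrSet X = X

/-- `f` preserves the `h`-ary relation `ρ`. -/
def Preserves (f : PF A) {h : ℕ} (ρ : Set (Fin h → A)) : Prop :=
  ∀ (M : Fin h → Fin (f.1+1) → A) (v : Fin h → A),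
    (∀ j, (fun i => M i j) ∈ ρ) → (∀ i, f.2 (M i) = some (v i)) → v ∈ ρ

def pPolSet {h : ℕ} (ρ : Set (Fin h → A)) : Set (PF A) := {f | Preserves f ρ}

def PolSet {h : ℕ} (ρ : Set (Fin h → A)) : Set (PF A) := pPolSet ρ ∩ OSet A

/-- `f` preserves the relation pair `(ρ, ρ')`. -/
def PreservesPair (f : PF A) {h : ℕ} (ρ ρ' : Set (Fin h → A)) : Prop :=
  ∀ (M : Fin h → Fin (f.1+1) → A) (v : Fin h → A),
    (∀ j, (fun i => M i j) ∈ ρ) → (∀ i, f.2 (M i) = some (v i)) → v ∈ ρ'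

def cPolSet {h : ℕ} (ρ ρ' : Set (Fin h → A)) : Set (PF A) := {f | PreservesPair f ρ ρ'}

/-- The interval `I_str(C)` of strong partial clones with total part `C`. -/
def Istr (C : Set (PF A)) : Set (Set (PF A)) :=
  {X | IsPartialClone X ∧ IsStrong X ∧ X ∩ OSet A = C}

/-! Maltsev operations -/

def zeta (f : PF A) : PF A := ⟨f.1, fun x => f.2 (fun i => x (i + 1))⟩

def tau (f : PF A) : PF A := ⟨f.1, fun x => f.2 (fun i => x (Equiv.swap 0 1 i))⟩

def nabla (f : PF A) : PF A := ⟨f.1 + 1, fun x => f.2 (fun i => x i.succ)⟩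

def delta (f : PF A) : PF A :=
  match f with
  | ⟨0, g⟩ => ⟨0, g⟩
  | ⟨n+1, g⟩ => ⟨n, fun x => g (fun i => x ⟨i.val - 1, by have := i.isLt; omega⟩)⟩

/-- `f ⋆ g`. -/
def starPF (f g : PF A) : PF A :=
  ⟨f.1 + g.1, fun x =>
    (g.2 (fun j => x ⟨j.val, by have := j.isLt; omega⟩)).bind
      (fun a => f.2 (fun i =>
        if i.val = 0 then a else x ⟨g.1 + i.val, by have := i.isLt; omega⟩))⟩

/-- A partial class: closed under `ζ`, `τ`, `Δ`, `∇` and `⋆`. -/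
def IsPartialClass (X : Set (PF A)) : Prop :=
  (∀ f ∈ X, zeta f ∈ X) ∧ (∀ f ∈ X, tau f ∈ X) ∧ (∀ f ∈ X, delta f ∈ X) ∧
  (∀ f ∈ X, nabla f ∈ X) ∧ (∀ f ∈ X, ∀ g ∈ X, starPF f g ∈ X)

def starSet (X Y : Set (PF A)) : Set (PF A) := {h | ∃ f ∈ X, ∃ g ∈ Y, h = starPF f g}

/-- The constant function of arity `n+1` with value `a`. -/
def constPF (a : A) (n : ℕ) : PF A := ⟨n, fun _ => some a⟩

/-- The total clone generated by a set `G` of total functions. -/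
def cloneGen (G : Set (PF A)) : Set (PF A) := ⋂₀ {C | IsClone C ∧ G ⊆ C}


/-! Boolean-specific definitions (`0 = false`, `1 = true`). -/

/-- `T_0 = Pol {(0)}`. -/
def relT0 : Set (Fin 1 → Bool) := {fun _ => false}

/-- `T_1 = Pol {(1)}`. -/
def relT1 : Set (Fin 1 → Bool) := {fun _ => true}

/-- `{(0,0),(0,1),(1,1)}`, defining the monotone functions. -/
def relM : Set (Fin 2 → Bool) := {![false, false], ![false, true], ![true, true]}

/-- `{(0,1),(1,0)}`, defining the self-dual functions. -/
def relS : Set (Fin 2 → Bool) := {![false, true], ![true, false]}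

/-- `{(x,x,y,y),(x,y,x,y),(x,y,y,x) : x,y ∈ 𝟚}`, defining the linear functions. -/
def relL : Set (Fin 4 → Bool) :=
  {v | ∃ x y : Bool, v = ![x, x, y, y] ∨ v = ![x, y, x, y] ∨ v = ![x, y, y, x]}

def T0 : Set (PF Bool) := PolSet relT0
def T1 : Set (PF Bool) := PolSet relT1
def Mclone : Set (PF Bool) := PolSet relM
def Sclone : Set (PF Bool) := PolSet relS
def Lclone : Set (PF Bool) := PolSet relL

/-- `ρ_{0,2} = {(0,0),(0,1),(1,0)}`. -/
def rel02 : Set (Fin 2 → Bool) := {![false, false], ![false, true], ![true, false]}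

/-- `T_{0,2} = Pol ρ_{0,2}`. -/
def T02 : Set (PF Bool) := PolSet rel02

/-- Cyclic successor on `Fin n`. -/
def cyc {n : ℕ} (i : Fin n) : Fin n := ⟨(i.val + 1) % n, Nat.mod_lt _ (by have := i.isLt; omega)⟩

/-- `R^{0,2}_{C,n}`: the cyclic-graph relation. -/
def RC (n : ℕ) : Set (Fin n → Bool) := {x | ∀ i : Fin n, ![x i, x (cyc i)] ∈ rel02}

/-- `R^{0,2}_{K,n}`: the complete-graph relation. -/
def RK (n : ℕ) : Set (Fin n → Bool) := {x | ∀ i j : Fin n, i ≠ j → ![x i, x j] ∈ rel02}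

/-- `R^{0,2}_n := R^{0,2}_{C,n} × R^{0,2}_{K,n} ⊆ 𝟚^{2n}`. -/
def R02 (n : ℕ) : Set (Fin (n + n) → Bool) :=
  {x | (fun i => x (Fin.castAdd n i)) ∈ RC n ∧ (fun i => x (Fin.natAdd n i)) ∈ RK n}

/-- The binary conjunction as a partial (total) function. -/
def andPF : PF Bool := ⟨1, fun x => some (x 0 && x 1)⟩

/-- The constant Boolean functions `c_0, c_1` of all arities. -/
def constantsBool : Set (PF Bool) :=
  {f | ∃ n : ℕ, f = constPF false n ∨ f = constPF true n}

/-- `C_{01}`: the clone generated by the constants `c_0, c_1`. -/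
def C01 : Set (PF Bool) := cloneGen constantsBool

/-- `Λ`: the clone generated by `∧, c_0, c_1`. -/
def LambdaClone : Set (PF Bool) := cloneGen (insert andPF constantsBool)

/-- The monster relation `R^Λ_m ⊆ 𝟚^{m+1}` (coordinates 0-indexed: index 0 is the paper's 1). -/
def RLam (m : ℕ) : Set (Fin (m+1) → Bool) :=
  {x | (x 0 = true ∨ ∃ j : Fin (m+1), j ≠ 0 ∧ x j = false) ∧
       ∀ i j1 j2 : Fin (m+1), i ≠ 0 → j1 ≠ 0 → j2 ≠ 0 → i ≠ j1 → i ≠ j2 → j1 ≠ j2 →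
         (x i = true ∨ x 0 = false ∨ x j1 = false ∨ x j2 = false)}

/-- `n(k,p) := (2k−1)p + 1`. -/
def nkp (k p : ℕ) : ℕ := (2 * k - 1) * p + 1

/-- The `n(k,p)`-ary partial function `τ_p^k`. -/
def tauPF (k p : ℕ) : PF Bool :=
  ⟨nkp k p - 1, fun x =>
    if ∀ i, x i = true then some true
    else if (Finset.univ.filter (fun i => x i = true)).card ≤ p then some false
    else none⟩

/-- `p_1 := 1`, `p_j := n(j, p_{j−1})` for `j ≥ 2`. -/
def pseq : ℕ → ℕ
  | 0 => 1
  | 1 => 1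
  | (j+2) => nkp (j+2) (pseq (j+1))

/-- `ξ_j := τ^{j+1}_{p_j}`. -/
def xi (j : ℕ) : PF Bool := tauPF (j + 1) (pseq j)

/-- `ρ_C = {(0,0,0,0),(0,0,1,1),(0,1,0,1),(1,1,1,1)}`. -/
def rhoC : Set (Fin 4 → Bool) :=
  {![false, false, false, false], ![false, false, true, true],
   ![false, true, false, true], ![true, true, true, true]}

/-- `ρ_1 = ρ_C ∪ {(1,0,1,0),(1,1,0,0)}`. -/
def rho1 : Set (Fin 4 → Bool) :=
  rhoC ∪ {![true, false, true, false], ![true, true, false, false]}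

/-- `f_a`: extension of `f` fixing the new first coordinate to `a`. -/
def extConst {A : Type} [DecidableEq A] (a : A) (f : PF A) : PF A :=
  ⟨f.1 + 1, fun x => if x 0 = a then f.2 (fun i => x i.succ) else none⟩



theorem compFun_eq_some {k m : ℕ} (f : (Fin k → A) → Option A)
    (g : Fin k → ((Fin m → A) → Option A)) (x : Fin m → A) (a : A) :
    compFun f g x = some a ↔ ∃ y : Fin k → A, (∀ i, g i x = some (y i)) ∧ f y = some a := by
  unfold compFun
  constructor
  · intro h
    split_ifs at h with h1
    exact ⟨_, fun i => by simp, h⟩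
  · rintro ⟨y, hy, hf⟩
    have h1 : ∀ i, (g i x).isSome := fun i => by simp [hy i]
    rw [dif_pos h1]
    have : (fun i => (g i x).get (h1 i)) = y := by
      funext i; simp [hy i]
    rw [this, hf]

theorem preserves_proj {h : ℕ} (ρ : Set (Fin h → A)) (n : ℕ) (i : Fin (n+1)) :
    Preserves (proj n i) ρ := by
  intro M v hM hv
  have : v = fun r => M r i := by
    funext r
    have := hv r
    simp only [proj, Option.some.injEq] at this
    exact this.symm
  rw [this]
  exact hM i

theorem preserves_comp {h : ℕ} (ρ : Set (Fin h → A)) (f : PF A) (hf : Preserves f ρ) (m : ℕ)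
    (g : Fin (f.1+1) → ((Fin (m+1) → A) → Option A))
    (hg : ∀ i, Preserves (⟨m, g i⟩ : PF A) ρ) : Preserves (⟨m, compFun f.2 g⟩ : PF A) ρ := by
  intro M v hM hv
  have h1 : ∀ r, ∃ y : Fin (f.1+1) → A, (∀ i, g i (M r) = some (y i)) ∧ f.2 y = some (v r) :=
    fun r => (compFun_eq_some _ _ _ _).1 (hv r)
  choose y hy hfy using h1
  refine hf y v (fun j => ?_) hfy
  exact hg j M (fun r => y r j) hM (fun r => hy r j)

theorem preserves_le {h : ℕ} (ρ : Set (Fin h → A)) (f g : PF A) (hg : Preserves g ρ)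
    (hle : PFle f g) : Preserves f ρ := by
  obtain ⟨n, f⟩ := f
  obtain ⟨n', g⟩ := g
  obtain ⟨e, hle⟩ := hle
  dsimp only at e
  subst e
  intro M v hM hv
  exact hg M v hM (fun i => hle _ _ (hv i))

def relH : Set (Fin 3 → Bool) := {v | v 0 = true → v 1 = true → v 2 = true}

def XS (S : Set ℕ) : Set (PF Bool) :=
  {f | Preserves f relT1 ∧ Preserves f relH ∧ ∀ m ∈ S, Preserves f (RLam (m+4))}

theorem XS_clone (S : Set ℕ) : IsPartialClone (XS S) := by
  refine ⟨fun n i => ⟨preserves_proj _ _ _, preserves_proj _ _ _,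
    fun m _ => preserves_proj _ _ _⟩, fun f hf m g hg => ⟨?_, ?_, ?_⟩⟩
  · exact preserves_comp _ f hf.1 m g (fun i => (hg i).1)
  · exact preserves_comp _ f hf.2.1 m g (fun i => (hg i).2.1)
  · exact fun k hk => preserves_comp _ f (hf.2.2 k hk) m g (fun i => (hg i).2.2 k hk)

theorem PFle_refl (f : PF A) : PFle f f := ⟨rfl, fun _ _ h => h⟩

theorem XS_strong (S : Set ℕ) : IsStrong (XS S) := by
  apply Set.Subset.antisymm
  · rintro f ⟨g, hg, hle⟩
    exact ⟨preserves_le _ f g hg.1 hle, preserves_le _ f g hg.2.1 hle,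
      fun m hm => preserves_le _ f g (hg.2.2 m hm) hle⟩
  · exact fun f hf => ⟨f, hf, PFle_refl f⟩

def DS : Set (PF Bool) :=
  {f | Preserves f relH ∧ (∀ m, Preserves f (RLam (m+4))) ∧ IsTotalPF f}

theorem DS_clone : IsClone DS := by
  refine ⟨⟨fun n i => ⟨preserves_proj _ _ _, fun m => preserves_proj _ _ _, fun x => rfl⟩,
    fun f hf m g hg => ⟨?_, ?_, ?_⟩⟩, fun f hf => hf.2.2⟩
  · exact preserves_comp _ f hf.1 m g (fun i => (hg i).1)
  · exact fun k => preserves_comp _ f (hf.2.1 k) m g (fun i => (hg i).2.1 k)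
  · intro x
    have h1 : ∀ i, (g i x).isSome := fun i => (hg i).2.2 x
    show (compFun f.2 g x).isSome
    unfold compFun
    rw [dif_pos h1]
    exact hf.2.2 _

theorem preserves_const {h : ℕ} (ρ : Set (Fin h → Bool)) (b : Bool) (n : ℕ)
    (hb : (fun _ => b) ∈ ρ) : Preserves (constPF b n) ρ := by
  intro M v _ hv
  have : v = fun _ => b := by
    funext r
    have := hv r
    simp only [constPF, Option.some.injEq] at this
    exact this.symm
  rwa [this]

theorem preserves_and {h : ℕ} (ρ : Set (Fin h → Bool))
    (hb : ∀ x ∈ ρ, ∀ y ∈ ρ, (fun i => x i && y i) ∈ ρ) : Preserves andPF ρ := by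
  intro M v hM hv
  have : v = fun r => M r 0 && M r 1 := by
    funext r
    have := hv r
    simp only [andPF, Option.some.injEq] at this
    exact this.symm
  rw [this]
  exact hb _ (hM 0) _ (hM 1)

theorem RLam_and (m : ℕ) : ∀ x ∈ RLam m, ∀ y ∈ RLam m, (fun i => x i && y i) ∈ RLam m := by
  rintro x ⟨hx1, hx2⟩ y ⟨hy1, hy2⟩
  refine ⟨?_, fun i j1 j2 h1 h2 h3 h4 h5 h6 => ?_⟩
  · rcases hx1 with hx1 | ⟨j, hj, hx⟩
    · rcases hy1 with hy1 | ⟨j, hj, hy⟩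
      · left; simp [hx1, hy1]
      · right; exact ⟨j, hj, by simp [hy]⟩
    · right; exact ⟨j, hj, by simp [hx]⟩
  · have a := hx2 i j1 j2 h1 h2 h3 h4 h5 h6
    have b := hy2 i j1 j2 h1 h2 h3 h4 h5 h6
    simp only [Bool.and_eq_true, Bool.and_eq_false_iff]
    tauto

theorem gen_sub_DS : insert andPF constantsBool ⊆ DS := by
  rintro f (rfl | ⟨n, rfl | rfl⟩)
  · refine ⟨preserves_and _ ?_, fun m => preserves_and _ (RLam_and _), fun x => rfl⟩
    intro x hx y hy
    simp only [relH, Set.mem_setOf_eq, Bool.and_eq_true] at *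
    tauto
  · refine ⟨preserves_const _ _ _ ?_, fun m => preserves_const _ _ _ ?_, fun x => rfl⟩
    · simp [relH]
    · refine ⟨Or.inr ⟨1, ?_, rfl⟩, by simp⟩
      simp [Fin.ext_iff]
  · refine ⟨preserves_const _ _ _ ?_, fun m => preserves_const _ _ _ ?_, fun x => rfl⟩
    · simp [relH]
    · exact ⟨Or.inl rfl, by simp⟩

theorem conj_mem (C : Set (PF Bool)) (hC : IsPartialClone C)
    (hG : insert andPF constantsBool ⊆ C) (n : ℕ) (s : Finset (Fin (n+1))) :
    (⟨n, fun x => some (decide (∀ i ∈ s, x i = true))⟩ : PF Bool) ∈ C := by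
  induction s using Finset.induction_on with
  | empty =>
    have : (constPF true n : PF Bool) ∈ C := hG (Or.inr ⟨n, Or.inr rfl⟩)
    have e : (fun x : Fin (n+1) → Bool => some (decide (∀ i ∈ (∅ : Finset (Fin (n+1))),
        x i = true))) = fun _ => some true := by
      funext x; simp
    rw [e]
    exact this
  | insert a s ha ih =>
    have hand : andPF ∈ C := hG (Or.inl rfl)
    have hA : ∀ g : Fin 2 → ((Fin (n+1) → Bool) → Option Bool),
        (∀ i, (⟨n, g i⟩ : PF Bool) ∈ C) →
        (⟨n, compFun (k := 2) (fun x => some (x 0 && x 1)) g⟩ : PF Bool) ∈ C :=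
      hC.2 andPF hand n
    have key := hA ![fun x => some (x a), fun x => some (decide (∀ i ∈ s, x i = true))] (by
        intro i
        fin_cases i
        · exact hC.1 n a
        · exact ih)
    have e : (fun x : Fin (n+1) → Bool => some (decide (∀ i ∈ insert a s, x i = true))) =
        compFun (k := 2) (fun x => some (x 0 && x 1))
          ![fun x => some (x a), fun x => some (decide (∀ i ∈ s, x i = true))] := by
      funext x
      symm
      rw [compFun_eq_some]
      refine ⟨![x a, decide (∀ i ∈ s, x i = true)], ?_, ?_⟩
      · intro i
        fin_cases i <;> rfl
      · simp
    rw [e]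
    exact key

theorem total_conj (f : PF Bool) (ht : IsTotalPF f) (h1 : Preserves f relT1)
    (hH : Preserves f relH) :
    ∃ s : Finset (Fin (f.1+1)), f = ⟨f.1, fun x => some (decide (∀ i ∈ s, x i = true))⟩ := by
  classical
  obtain ⟨n, f⟩ := f
  have htt : ∀ x, ∃ b, f x = some b := fun x => Option.isSome_iff_exists.1 (ht x)
  choose F hF using htt
  have hH' : ∀ x y z : Fin (n+1) → Bool, (∀ j, x j = true → y j = true → z j = true) →
      F x = true → F y = true → F z = true := by
    intro x y z hxyz
    have := hH ![x, y, z] ![F x, F y, F z] (fun j => hxyz j) (by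
      intro i
      fin_cases i <;> exact hF _)
    exact this
  have h1' : F (fun _ => true) = true := by
    have := h1 (fun _ _ => true) (fun _ => F (fun _ => true)) (fun j => rfl) (fun i => hF _)
    exact congrFun this 0
  refine ⟨Finset.univ.filter (fun i => ∀ x, F x = true → x i = true), ?_⟩
  have main : ∀ s : Finset (Fin (n+1)), ∃ y, F y = true ∧
      ∀ i ∈ s, (∃ x, F x = true ∧ x i = false) → y i = false := by
    intro s
    induction s using Finset.induction_on with
    | empty => exact ⟨_, h1', by simp⟩
    | insert a s ha ih =>
      obtain ⟨y, hy, hys⟩ := ih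
      by_cases hx : ∃ x, F x = true ∧ x a = false
      · obtain ⟨x, hx, hxa⟩ := hx
        refine ⟨fun i => x i && y i, hH' x y _ (by simp +contextual) hx hy, ?_⟩
        intro i hi hi2
        rcases Finset.mem_insert.1 hi with rfl | hi
        · simp [hxa]
        · simp [hys i hi hi2]
      · refine ⟨y, hy, ?_⟩
        intro i hi hi2
        rcases Finset.mem_insert.1 hi with rfl | hi
        · exact absurd hi2 hx
        · exact hys i hi hi2
  obtain ⟨y, hy, hyu⟩ := main Finset.univ
  have : f = fun x => some (decide (∀ i ∈ Finset.univ.filter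
      (fun i => ∀ x, F x = true → x i = true), x i = true)) := by
    funext x
    rw [hF x]
    congr 1
    rw [Bool.eq_iff_iff, decide_eq_true_iff]
    constructor
    · intro hx i hi
      exact (Finset.mem_filter.1 hi).2 x hx
    · intro hx
      refine hH' y y x (fun j hj _ => hx j (Finset.mem_filter.2 ⟨Finset.mem_univ _, ?_⟩)) hy hy
      intro z hz
      by_contra hzj
      have := hyu j (Finset.mem_univ _) ⟨z, hz, by simpa using hzj⟩
      simp [hj] at this
  exact congrArg (fun g => (⟨n, g⟩ : PF Bool)) this

theorem XS_total (S : Set ℕ) : XS S ∩ OSet Bool = LambdaClone ∩ T1 := by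
  apply Set.Subset.antisymm
  · rintro f ⟨hf, ht⟩
    refine ⟨?_, hf.1, ht⟩
    obtain ⟨s, hs⟩ := total_conj f ht hf.1 hf.2.1
    rintro C ⟨hC, hG⟩
    rw [hs]
    exact conj_mem C hC.1 hG _ s
  · rintro f ⟨hL, h1, ht⟩
    have : f ∈ DS := hL DS ⟨DS_clone, gen_sub_DS⟩
    exact ⟨⟨h1, this.1, fun m _ => this.2.1 m⟩, ht⟩

theorem XS_mem (S : Set ℕ) : XS S ∈ Istr (LambdaClone ∩ T1) :=
  ⟨XS_clone S, XS_strong S, XS_total S⟩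

/-- low tuples -/
theorem low_mem (m : ℕ) (x : Fin (m+1) → Bool) (h0 : x 0 = false)
    (h : ∃ j, j ≠ 0 ∧ x j = false) : x ∈ RLam m :=
  ⟨Or.inr h, fun _ _ _ _ _ _ _ _ _ => Or.inr (Or.inl h0)⟩

theorem high_mem (m : ℕ) (k : Fin (m+1)) :
    (fun i => decide (i = 0 ∨ i = k)) ∈ RLam m := by
  refine ⟨Or.inl (by simp), fun i j1 j2 h1 h2 h3 h4 h5 h6 => ?_⟩
  simp only [decide_eq_true_eq, decide_eq_false_iff_not]
  by_cases a : j1 = k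
  · right; right; right
    rintro (h | h)
    · exact h3 h
    · exact h6 (a.trans h.symm)
  · right; right; left
    rintro (h | h)
    · exact h2 h
    · exact a h

theorem exists_col (m : ℕ) : ∃ (n : ℕ) (c : Fin (n+1) → (Fin (m+1) → Bool)),
    Set.range c = RLam m := by
  classical
  have : Nonempty (RLam m) := ⟨⟨_, high_mem m 0⟩⟩
  have hc : Fintype.card (RLam m) ≠ 0 := Fintype.card_ne_zero
  obtain ⟨n, hn⟩ := Nat.exists_eq_succ_of_ne_zero hc
  let e : RLam m ≃ Fin (n+1) := Fintype.equivFinOfCardEq hn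
  refine ⟨n, fun i => (e.symm i).1, ?_⟩
  ext x
  constructor
  · rintro ⟨i, rfl⟩
    exact (e.symm i).2
  · intro hx
    exact ⟨e ⟨x, hx⟩, by simp⟩

theorem exists_fn (m : ℕ) (hm : 2 ≤ m) : ∃ f : PF Bool, ∀ (h : ℕ) (ρ : Set (Fin h → Bool)),
    Preserves f ρ ↔ ∀ φ : Fin h → Fin (m+1), (∀ x ∈ RLam m, (fun i => x (φ i)) ∈ ρ) →
      (fun i => decide (φ i ≠ 0)) ∈ ρ := by
  classical
  obtain ⟨n, c, hc⟩ := exists_col m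
  let a : Fin (m+1) → Fin (n+1) → Bool := fun k j => c j k
  have ha : ∀ k, k ≠ 0 → a k ≠ a 0 := by
    intro k hk he
    have h1 : (fun i => decide (i = k)) ∈ RLam m := by
      refine low_mem m _ (by simpa using hk.symm) ?_
      by_cases hk1 : k = ⟨1, by omega⟩
      · exact ⟨⟨2, by omega⟩, by simp [Fin.ext_iff], by simp [hk1]⟩
      · exact ⟨⟨1, by omega⟩, by simp [Fin.ext_iff], by simpa using fun h => hk1 h.symm⟩
    rw [← hc] at h1
    obtain ⟨j, hj⟩ := h1
    have := congrFun he j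
    simp only [a, hj] at this
    simp [hk.symm] at this
  let f : (Fin (n+1) → Bool) → Option Bool := fun x =>
    if x = a 0 then some false else if ∃ k, x = a k then some true else none
  have hf1 : ∀ k, f (a k) = some (decide (k ≠ 0)) := by
    intro k
    by_cases hk : k = 0
    · simp [f, hk]
    · simp [f, hk, ha k hk]
  have hf2 : ∀ x b, f x = some b → ∃ k, x = a k ∧ decide (k ≠ 0) = b := by
    intro x b h
    have hx : ∃ k, x = a k := by
      by_contra hx
      have h0 : x ≠ a 0 := fun h => hx ⟨0, h⟩
      simp [f, h0, hx] at h
    obtain ⟨k, rfl⟩ := hx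
    rw [hf1] at h
    exact ⟨k, rfl, Option.some.inj h⟩
  refine ⟨⟨n, f⟩, fun h ρ => ⟨?_, ?_⟩⟩
  · intro hp φ hφ
    refine hp (fun i => a (φ i)) _ (fun j => ?_) (fun i => hf1 _)
    exact hφ (c j) (hc ▸ ⟨j, rfl⟩)
  · intro hp M v hM hv
    choose φ h1 h2 using fun i => hf2 _ _ (hv i)
    have : v = fun i => decide (φ i ≠ 0) := by funext i; exact (h2 i).symm
    rw [this]
    apply hp
    intro x hx
    rw [← hc] at hx
    obtain ⟨j, rfl⟩ := hx
    have := hM j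
    simpa only [h1] using this

theorem low3 (m : ℕ) (hm : 4 ≤ m) (a b c : Fin (m+1)) (ha : a ≠ 0) (hb : b ≠ 0) (hc : c ≠ 0) :
    (fun i => decide (i = a ∨ i = b ∨ i = c)) ∈ RLam m := by
  classical
  refine low_mem m _ (by simpa using ⟨ha.symm, hb.symm, hc.symm⟩) ?_
  have h1 : ({0, a, b, c} : Finset (Fin (m+1))).card < (Finset.univ : Finset (Fin (m+1))).card := by
    have := Finset.card_le_four (a := (0 : Fin (m+1))) (b := a) (c := b) (d := c)
    simp only [Finset.card_univ, Fintype.card_fin]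
    omega
  obtain ⟨j, _, hj⟩ := Finset.exists_mem_notMem_of_card_lt_card h1
  simp only [Finset.mem_insert, Finset.mem_singleton, not_or] at hj
  exact ⟨j, hj.1, by simpa using hj.2⟩

theorem sep (m : ℕ) (hm : 4 ≤ m) : ∃ f : PF Bool, Preserves f relT1 ∧ Preserves f relH ∧
    ∀ m', Preserves f (RLam m') ↔ m' ≠ m := by
  classical
  obtain ⟨f, hf⟩ := exists_fn m (by omega)
  have low3' := low3 m hm
  refine ⟨f, ?_, ?_, fun m' => ⟨?_, ?_⟩⟩
  · rw [hf]
    intro φ h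
    have h0 : (fun _ => false) ∈ RLam m :=
      low_mem m _ rfl ⟨⟨1, by omega⟩, by simp [Fin.ext_iff], rfl⟩
    have := congrFun (h _ h0) 0
    simp at this
  · rw [hf]
    intro φ h h0 h1
    simp only [decide_eq_true_eq] at h0 h1
    have := h _ (low3' _ _ _ h0 h1 h1)
    have := this (by simp) (by simp)
    simp only [decide_eq_true_eq] at this ⊢
    rcases this with h | h | h <;> rw [h] <;> assumption
  · rintro hp rfl
    rw [hf] at hp
    have := (hp id (fun x hx => hx)).1
    simp at this
  · intro hne
    rw [hf]
    intro φ h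
    refine ⟨?_, ?_⟩
    · by_contra hcon
      simp only [decide_eq_true_eq, decide_eq_false_iff_not, not_or, not_not, not_exists,
        not_and] at hcon
      obtain ⟨h0, h1⟩ := hcon
      -- surjectivity
      have hsurj : ∀ k : Fin (m+1), k ≠ 0 → ∃ j, j ≠ 0 ∧ φ j = k := by
        intro k hk
        by_contra hno
        push Not at hno
        have hx : (fun i => decide (i ≠ 0 ∧ i ≠ k)) ∈ RLam m :=
          low_mem m _ (by simp) ⟨k, hk, by simp⟩
        have := (h _ hx).1
        rcases this with h | ⟨j, hj, h⟩
        · simp [h0] at h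
        · simp only [decide_eq_false_iff_not] at h
          exact h ⟨h1 j hj, hno j hj⟩
      have hinj : ∀ j1 j2, j1 ≠ 0 → j2 ≠ 0 → φ j1 = φ j2 → j1 = j2 := by
        intro j1 j2 hj1 hj2 he
        by_contra hj
        obtain ⟨k, hk0, hk⟩ : ∃ k : Fin (m+1), k ≠ 0 ∧ k ≠ φ j1 := by
          by_cases hk : φ j1 = ⟨1, by omega⟩
          · exact ⟨⟨2, by omega⟩, by simp [Fin.ext_iff], by simp [hk]⟩
          · exact ⟨⟨1, by omega⟩, by simp [Fin.ext_iff], fun h => hk h.symm⟩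
        obtain ⟨i, hi0, hi⟩ := hsurj k hk0
        have := (h _ (high_mem m (φ j1))).2 i j1 j2 hi0 hj1 hj2
          (by rintro rfl; exact hk hi.symm) (by rintro rfl; exact hk (hi.symm.trans he.symm)) hj
        simp [h0, hi, hk0, he] at this
        exact hk (this.trans he.symm)
      have hbij : Function.Bijective φ := by
        constructor
        · intro x y hxy
          by_cases hx : x = 0
          · by_cases hy : y = 0
            · rw [hx, hy]
            · subst hx; exact absurd (hxy.symm.trans h0) (h1 y hy)
          · by_cases hy : y = 0
            · subst hy; exact absurd (hxy.trans h0) (h1 x hx)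
            · exact hinj x y hx hy hxy
        · intro k
          by_cases hk : k = 0
          · exact ⟨0, by rw [h0, hk]⟩
          · obtain ⟨j, _, hj⟩ := hsurj k hk
            exact ⟨j, hj⟩
      have := Fintype.card_of_bijective hbij
      simp at this
      exact hne this
    · intro i j1 j2 hi hj1 hj2 h4 h5 h6
      by_contra hcon
      simp only [decide_eq_true_eq, decide_eq_false_iff_not, not_or, not_not] at hcon
      obtain ⟨a, b, c, d⟩ := hcon
      have := (h _ (low3' _ _ _ b c d)).2 i j1 j2 hi hj1 hj2 h4 h5 h6
      simp [a, Ne.symm b, Ne.symm c, Ne.symm d] at this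

theorem XS_inj : Function.Injective XS := by
  have key : ∀ S : Set ℕ, ∀ m, m ∈ S ↔ ¬ (Classical.choose (sep (m+4) (by omega)) ∈ XS S) := by
    intro S m
    have hs := Classical.choose_spec (sep (m+4) (by omega))
    set f := Classical.choose (sep (m+4) (by omega))
    constructor
    · intro hm hf
      exact (hs.2.2 (m+4)).1 (hf.2.2 m hm) rfl
    · intro hf
      by_contra hm
      apply hf
      refine ⟨hs.1, hs.2.1, fun m' hm' => (hs.2.2 _).2 ?_⟩
      intro he
      have : m' = m := by omega
      exact hm (this ▸ hm')
  intro S T h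
  ext m
  rw [key S, key T, h]

theorem Istr_Lambda_inter_T1_continuum :
    Cardinal.mk ↥(Istr (LambdaClone ∩ T1)) = Cardinal.continuum := by
  apply le_antisymm
  · have hc : Countable (PF Bool) := by unfold PF; infer_instance
    calc Cardinal.mk ↥(Istr (LambdaClone ∩ T1)) ≤ Cardinal.mk (Set (PF Bool)) :=
          Cardinal.mk_set_le _
      _ = 2 ^ Cardinal.mk (PF Bool) := Cardinal.mk_set
      _ ≤ 2 ^ Cardinal.aleph0 :=
          Cardinal.power_le_power_left two_ne_zero (Cardinal.mk_le_aleph0_iff.2 hc)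
      _ = Cardinal.continuum := Cardinal.two_power_aleph0
  · have : Function.Injective (fun S : Set ℕ => (⟨XS S, XS_mem S⟩ : ↥(Istr (LambdaClone ∩ T1)))) :=
      fun S T h => XS_inj (congrArg Subtype.val h)
    have h2 := Cardinal.mk_le_of_injective this
    rwa [Cardinal.mk_set, Cardinal.mk_nat, Cardinal.two_power_aleph0] at h2

end StrongPartial
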